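/- Let m > 1 and let Y ∈ C([0,1], ℝ^d) satisfy Y(t) = Y(0) − ∫_0^t |Y(s)|^{m−1} Y(s) ds + Z(t) for all t ∈ [0,1], for some Z ∈ C([0,1], ℝ^d) with Z(0) = 0. Then there is a constant C depending only on m such that for every α ∈ (0,1), every t ∈ (0,1] and every L ∈ (0,t): |Y(t)| ≤ C · max{ (t−L)^{−1/(m−1)}, ( sup_{s ∈ [L,t]} [Z]_{α,[s−L,s]} · L^{α−1} )^{1/m}, ( L^α ‖Y‖_{[0,t]}^{m−1} · sup_{s ∈ [L,t]} [Y]_{α,[s−L,s]} )^{1/m}, L^α [Y]_{α,[t−L,t]} }. -/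

import Mathlib

open scoped BigOperators ENNReal

noncomputable section

/-- Extended-real-valued `α`-Hölder seminorm of `W` over the interval `I`. -/
def eHolder {E : Type*} [NormedAddCommGroup E] (α : ℝ) (I : Set ℝ) (W : ℝ → E) : ℝ≥0∞ :=
  ⨆ s ∈ I, ⨆ t ∈ I, ⨆ _ : s < t, ENNReal.ofReal (‖W t - W s‖ / (t - s) ^ α)

/-- Extended-real-valued supremum norm of `W` over the interval `I`. -/
def eSupNorm {E : Type*} [NormedAddCommGroup E] (I : Set ℝ) (W : ℝ → E) : ℝ≥0∞ :=
  ⨆ s ∈ I, (‖W s‖₊ : ℝ≥0∞)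

theorem norm_le_of_damped_deriv {E : Type*} [NormedAddCommGroup E] [InnerProductSpace ℝ E]
    {m a t B l : ℝ} (hm : 1 < m) (hat : a < t) (hl : 0 < l) (hB : 2 * B ≤ l ^ m)
    {X X' : ℝ → E} (hX : ∀ s ∈ Set.Icc a t, HasDerivAt X (X' s) s)
    (hE : ∀ s ∈ Set.Icc a t, ‖X' s + ‖X s‖ ^ (m - 1) • X s‖ ≤ B) :
    ‖X t‖ ≤ max l (((m - 1) / 2 * (t - a)) ^ (-(1 / (m - 1)))) := by
  have hg : ∀ s ∈ Set.Icc a t,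
      HasDerivAt (fun s => ‖X s‖ ^ 2) (2 * inner ℝ (X s) (X' s)) s :=
    fun s hs => (hX s hs).norm_sq
  have hg' : ∀ s ∈ Set.Icc a t, l ≤ ‖X s‖ →
      2 * inner ℝ (X s) (X' s) ≤ -‖X s‖ ^ (m + 1) := by
    intro s hs hls
    have hr : 0 < ‖X s‖ := hl.trans_le hls
    have h1 : inner ℝ (X s) (X' s) =
        inner ℝ (X s) (X' s + ‖X s‖ ^ (m - 1) • X s) - ‖X s‖ ^ (m + 1) := by
      rw [inner_add_right, inner_smul_right, real_inner_self_eq_norm_sq]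
      have : ‖X s‖ ^ (m + 1) = ‖X s‖ ^ (m - 1) * ‖X s‖ ^ 2 := by
        rw [← Real.rpow_natCast, ← Real.rpow_add hr]; norm_num
        congr 1; ring
      rw [this]; ring
    have h2 : inner ℝ (X s) (X' s + ‖X s‖ ^ (m - 1) • X s) ≤ ‖X s‖ * B :=
      (real_inner_le_norm _ _).trans (by gcongr; exact hE s hs)
    have h3 : 2 * B ≤ ‖X s‖ ^ m := hB.trans (by gcongr)
    have h4 : ‖X s‖ ^ (m + 1) = ‖X s‖ * ‖X s‖ ^ m := by
      rw [Real.rpow_add hr, Real.rpow_one]; ring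
    have h5 : ‖X s‖ * (2 * B) ≤ ‖X s‖ * ‖X s‖ ^ m := by gcongr
    rw [h1]; linarith
  by_cases hex : ∃ s ∈ Set.Icc a t, ‖X s‖ ≤ l
  · obtain ⟨s, hs, hsl⟩ := hex
    have hsub : ∀ x ∈ Set.Icc s t, x ∈ Set.Icc a t := fun x hx => ⟨hs.1.trans hx.1, hx.2⟩
    have key := image_le_of_deriv_right_lt_deriv_boundary (a := s) (b := t)
      (f := fun s => ‖X s‖ ^ 2) (f' := fun s => 2 * inner ℝ (X s) (X' s))
      (B := fun _ => l ^ 2) (B' := fun _ => 0)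
      (fun x hx => (hg x (hsub x hx)).continuousAt.continuousWithinAt)
      (fun x hx => (hg x (hsub x ⟨hx.1, hx.2.le⟩)).hasDerivWithinAt)
      (by gcongr) (fun x => hasDerivAt_const x _)
      (fun x hx hxl => by
        have hxl' : ‖X x‖ = l := by
          simpa [abs_of_pos hl] using (sq_eq_sq_iff_abs_eq_abs _ _).1 hxl
        have := hg' x (hsub x ⟨hx.1, hx.2.le⟩) hxl'.ge
        rw [hxl'] at this
        have : 0 < l ^ (m + 1) := Real.rpow_pos_of_pos hl _
        linarith)
      (Set.right_mem_Icc.2 hs.2)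
    exact le_max_of_le_left (by simpa using (sq_le_sq₀ (norm_nonneg _) hl.le).1 key)
  · push Not at hex
    have hpos : ∀ s ∈ Set.Icc a t, 0 < ‖X s‖ := fun s hs => hl.trans (hex s hs)
    have hd : ∀ s ∈ Set.Icc a t,
        HasDerivAt (fun s => (‖X s‖ ^ 2) ^ (-(m - 1) / 2) - (m - 1) / 2 * s)
          (2 * inner ℝ (X s) (X' s) * (-(m - 1) / 2) * (‖X s‖ ^ 2) ^ (-(m - 1) / 2 - 1)
            - (m - 1) / 2 * 1) s := fun s hs =>
      ((hg s hs).rpow_const (Or.inl (pow_pos (hpos s hs) 2).ne')).sub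
        ((hasDerivAt_id s).const_mul _)
    have hmono : MonotoneOn (fun s => (‖X s‖ ^ 2) ^ (-(m - 1) / 2) - (m - 1) / 2 * s)
        (Set.Icc a t) := by
      refine monotoneOn_of_hasDerivWithinAt_nonneg (convex_Icc a t)
        (fun s hs => (hd s hs).continuousAt.continuousWithinAt)
        (fun s hs => (hd s (interior_subset hs)).hasDerivWithinAt) ?_
      intro s hs
      have hs := interior_subset hs
      have hr := hpos s hs
      have h1 := hg' s hs (hex s hs).le
      have h2 : (‖X s‖ ^ 2) ^ (-(m - 1) / 2 - 1) = (‖X s‖ ^ (m + 1))⁻¹ := by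
        rw [← Real.rpow_natCast, ← Real.rpow_mul hr.le, ← Real.rpow_neg hr.le]
        congr 1; push_cast; ring
      have h3 : 0 < ‖X s‖ ^ (m + 1) := Real.rpow_pos_of_pos hr _
      have h4 : 1 ≤ -(2 * inner ℝ (X s) (X' s)) * (‖X s‖ ^ (m + 1))⁻¹ := by
        rw [← div_eq_mul_inv, le_div_iff₀ h3]; linarith
      rw [h2]
      nlinarith
    have h1 := hmono (Set.left_mem_Icc.2 hat.le) (Set.right_mem_Icc.2 hat.le) hat.le
    simp only at h1
    have h2 : 0 ≤ (‖X a‖ ^ 2) ^ (-(m - 1) / 2) := by positivity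
    have hr := hpos t (Set.right_mem_Icc.2 hat.le)
    have h3 : (‖X t‖ ^ 2) ^ (-(m - 1) / 2) = ‖X t‖ ^ (-(m - 1)) := by
      rw [← Real.rpow_natCast, ← Real.rpow_mul hr.le]
      congr 1; push_cast; ring
    have hk : 0 < (m - 1) / 2 * (t - a) := mul_pos (by linarith) (by linarith)
    have h4 : (m - 1) / 2 * (t - a) ≤ ‖X t‖ ^ (-(m - 1)) := by rw [← h3]; linarith
    refine le_max_of_le_right ?_
    have h5 := Real.rpow_le_rpow_of_nonpos hk h4
      (z := -(1 / (m - 1))) (by simp only [Left.neg_nonpos_iff]; have : 0 < m - 1 := by linarith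
                                positivity)
    rwa [← Real.rpow_mul hr.le, show -(m - 1) * -(1 / (m - 1)) = 1 by
      have : m - 1 ≠ 0 := by linarith
      field_simp, Real.rpow_one] at h5

theorem norm_rpow_smul_sub_le {E : Type*} [NormedAddCommGroup E] [NormedSpace ℝ E]
    {m M : ℝ} (hm : 1 < m) {x y : E} (hx : ‖x‖ ≤ M) (hy : ‖y‖ ≤ M) :
    ‖‖x‖ ^ (m - 1) • x - ‖y‖ ^ (m - 1) • y‖ ≤ (m + 1) * (M ^ (m - 1) * ‖x - y‖) := by
  wlog hxy : ‖y‖ ≤ ‖x‖ generalizing x y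
  · rw [norm_sub_rev, norm_sub_rev x y]
    exact this hy hx (le_of_not_ge hxy)
  rcases (norm_nonneg x).eq_or_lt with h0 | h0
  · have hx0 : x = 0 := norm_eq_zero.1 h0.symm
    have hy0 : y = 0 := norm_le_zero_iff.1 (h0 ▸ hxy)
    simp [hx0, hy0]
  have hmul : ∀ {r : ℝ}, 0 ≤ r → r ^ m = r ^ (m - 1) * r := by
    intro r hr
    rw [← Real.rpow_add_one' hr (by linarith), sub_add_cancel]
  have bern : ‖x‖ ^ m - ‖y‖ ^ m ≤ m * (‖x‖ ^ (m - 1) * (‖x‖ - ‖y‖)) := by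
    have h1 := one_add_mul_self_le_rpow_one_add (s := ‖y‖ / ‖x‖ - 1) (p := m)
      (by linarith [div_nonneg (norm_nonneg y) h0.le]) hm.le
    rw [add_sub_cancel, Real.div_rpow (norm_nonneg _) h0.le,
      le_div_iff₀ (Real.rpow_pos_of_pos h0 m)] at h1
    have h2 : (1 + m * (‖y‖ / ‖x‖ - 1)) * ‖x‖ ^ m =
        ‖x‖ ^ m - m * (‖x‖ ^ (m - 1) * (‖x‖ - ‖y‖)) := by
      rw [hmul h0.le]; field_simp; ring
    linarith
  have hpow : ‖y‖ ^ (m - 1) ≤ ‖x‖ ^ (m - 1) :=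
    Real.rpow_le_rpow (norm_nonneg _) hxy (by linarith)
  have hpowM : ‖x‖ ^ (m - 1) ≤ M ^ (m - 1) :=
    Real.rpow_le_rpow (norm_nonneg _) hx (by linarith)
  have hxp : 0 ≤ ‖x‖ ^ (m - 1) := by positivity
  calc ‖‖x‖ ^ (m - 1) • x - ‖y‖ ^ (m - 1) • y‖
      = ‖‖x‖ ^ (m - 1) • (x - y) + (‖x‖ ^ (m - 1) - ‖y‖ ^ (m - 1)) • y‖ := by
        congr 1; module
    _ ≤ ‖x‖ ^ (m - 1) * ‖x - y‖ + (‖x‖ ^ (m - 1) - ‖y‖ ^ (m - 1)) * ‖y‖ := by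
        refine (norm_add_le _ _).trans ?_
        rw [norm_smul, norm_smul, Real.norm_of_nonneg hxp,
          Real.norm_of_nonneg (sub_nonneg.2 hpow)]
    _ ≤ ‖x‖ ^ (m - 1) * ‖x - y‖ + m * (‖x‖ ^ (m - 1) * (‖x‖ - ‖y‖)) := by
        have h1 := hmul (norm_nonneg x)
        have h2 := hmul (norm_nonneg y)
        have h3 : ‖x‖ ^ (m - 1) * ‖y‖ ≤ ‖x‖ ^ (m - 1) * ‖x‖ := by gcongr
        linarith
    _ ≤ ‖x‖ ^ (m - 1) * ‖x - y‖ + m * (‖x‖ ^ (m - 1) * ‖x - y‖) := by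
        gcongr; exact norm_sub_norm_le x y
    _ = (m + 1) * (‖x‖ ^ (m - 1) * ‖x - y‖) := by ring
    _ ≤ _ := by gcongr

/-- If all values of `Y` on `[a, b]` are close to `c`, so is its average. -/
theorem norm_average_sub_le {E : Type*} [NormedAddCommGroup E] [NormedSpace ℝ E] [CompleteSpace E]
    {Y : ℝ → E} (hY : Continuous Y) {a L K : ℝ} (hL : 0 < L) {c : E}
    (h : ∀ u ∈ Set.Icc (a - L) a, ‖Y u - c‖ ≤ K) :
    ‖L⁻¹ • (∫ u in (a - L)..a, Y u) - c‖ ≤ K := by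
  have h1 : L⁻¹ • (∫ u in (a - L)..a, Y u) - c = L⁻¹ • ∫ u in (a - L)..a, (Y u - c) := by
    rw [intervalIntegral.integral_sub (hY.intervalIntegrable _ _) (by simp), smul_sub,
      intervalIntegral.integral_const, sub_sub_cancel, smul_smul, inv_mul_cancel₀ hL.ne', one_smul]
  have h2 := intervalIntegral.norm_integral_le_of_norm_le_const (a := a - L) (b := a)
    (f := fun u => Y u - c) (C := K) (fun u hu => by
      rw [Set.uIoc_of_le (by linarith)] at hu
      exact h u ⟨hu.1.le, hu.2⟩)
  rw [h1, norm_smul, norm_inv, Real.norm_of_nonneg hL.le, inv_mul_le_iff₀ hL]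
  rwa [sub_sub_cancel, abs_of_pos hL, mul_comm] at h2

theorem norm_le_of_damped_increments {E : Type*} [NormedAddCommGroup E] [InnerProductSpace ℝ E]
    [CompleteSpace E] {m t L A M : ℝ} (hm : 1 < m) (hL : 0 < L) (hLt : L < t)
    {Y : ℝ → E} (hYc : Continuous Y)
    (hA : (t - L) ^ (-(1 / (m - 1))) ≤ A)
    (hM : ∀ s ∈ Set.Icc 0 t, ‖Y s‖ ≤ M)
    (hZ : ∀ s ∈ Set.Icc L t,
      ‖Y s - Y (s - L) + ∫ u in (s - L)..s, ‖Y u‖ ^ (m - 1) • Y u‖ ≤ A ^ m * L)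
    (hY : ∀ s ∈ Set.Icc L t, ∀ u ∈ Set.Icc (s - L) s, ∀ v ∈ Set.Icc (s - L) s,
      M ^ (m - 1) * ‖Y u - Y v‖ ≤ A ^ m)
    (hYt : ∀ u ∈ Set.Icc (t - L) t, ‖Y u - Y t‖ ≤ A) :
    ‖Y t‖ ≤ (1 + 2 * (m + 2) + ((m - 1) / 2) ^ (-(1 / (m - 1)))) * A := by
  have hApos : 0 < A := (Real.rpow_pos_of_pos (by linarith) _).trans_le hA
  have hfc : Continuous fun u => ‖Y u‖ ^ (m - 1) • Y u :=
    (hYc.norm.rpow_const fun _ => Or.inr (by linarith)).smul hYc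
  have hM0 : 0 ≤ M := (norm_nonneg _).trans (hM 0 ⟨le_rfl, by linarith⟩)
  set X : ℝ → E := fun s => L⁻¹ • ∫ u in (s - L)..s, Y u with hXdef
  have hX : ∀ s, HasDerivAt X (L⁻¹ • (Y s - Y (s - L))) s := by
    intro s
    have hF : ∀ s, HasDerivAt (fun s => ∫ u in (0 : ℝ)..s, Y u) (Y s) s :=
      fun s => hYc.integral_hasStrictDerivAt 0 s |>.hasDerivAt
    have h1 : X = fun s => L⁻¹ • ((∫ u in (0 : ℝ)..s, Y u) - ∫ u in (0 : ℝ)..(s - L), Y u) := by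
      funext s
      rw [hXdef, intervalIntegral.integral_interval_sub_left]
      all_goals exact hYc.intervalIntegrable _ _
    rw [h1]
    exact ((hF s).sub ((hF (s - L)).comp_sub_const s L)).const_smul _
  have hXM : ∀ s ∈ Set.Icc L t, ‖X s‖ ≤ M := by
    intro s hs
    simpa using norm_average_sub_le hYc hL (c := 0) (a := s) (K := M) fun u hu => by
      simpa using hM u ⟨by linarith [hu.1, hs.1], hu.2.trans hs.2⟩
  have hXY : ∀ s ∈ Set.Icc L t, ∀ u ∈ Set.Icc (s - L) s,
      M ^ (m - 1) * ‖Y u - X s‖ ≤ A ^ m := by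
    intro s hs u hu
    rcases (Real.rpow_nonneg hM0 (m - 1)).eq_or_lt with h0 | h0
    · rw [← h0, zero_mul]; positivity
    rw [mul_comm, ← le_div_iff₀ h0, norm_sub_rev]
    refine norm_average_sub_le hYc hL fun v hv => ?_
    rw [le_div_iff₀ h0, mul_comm]
    exact hY s hs v hv u hu
  have hE : ∀ s ∈ Set.Icc L t,
      ‖L⁻¹ • (Y s - Y (s - L)) + ‖X s‖ ^ (m - 1) • X s‖ ≤ (m + 2) * A ^ m := by
    intro s hs
    have h1 : ‖L⁻¹ • (∫ u in (s - L)..s, ‖Y u‖ ^ (m - 1) • Y u) - ‖X s‖ ^ (m - 1) • X s‖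
        ≤ (m + 1) * A ^ m :=
      norm_average_sub_le hfc hL fun u hu =>
        (norm_rpow_smul_sub_le hm (hM u ⟨by linarith [hu.1, hs.1], hu.2.trans hs.2⟩)
          (hXM s hs)).trans (by gcongr; exact hXY s hs u hu)
    have h2 : ‖L⁻¹ • (Y s - Y (s - L) + ∫ u in (s - L)..s, ‖Y u‖ ^ (m - 1) • Y u)‖ ≤ A ^ m := by
      rw [norm_smul, norm_inv, Real.norm_of_nonneg hL.le, inv_mul_le_iff₀ hL, mul_comm]
      exact hZ s hs
    have h3 := norm_sub_le_of_le h2 h1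
    calc _ = _ := by congr 1; module
      _ ≤ _ := h3
      _ = _ := by ring
  have hc : 2 * ((m + 2) * A ^ m) ≤ (2 * (m + 2) * A) ^ m := by
    rw [Real.mul_rpow (by linarith) hApos.le, ← mul_assoc]
    gcongr
    exact Real.self_le_rpow_of_one_le (by linarith) hm.le
  have h1 := norm_le_of_damped_deriv hm hLt
    (by have : 0 < m + 2 := by linarith
        positivity) hc (fun s _ => hX s) hE
  have h2 : ((m - 1) / 2 * (t - L)) ^ (-(1 / (m - 1))) ≤ ((m - 1) / 2) ^ (-(1 / (m - 1))) * A := by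
    rw [Real.mul_rpow (by linarith) (by linarith)]
    have : 0 ≤ (m - 1) / 2 := by linarith
    gcongr
  have h3 : ‖X t - Y t‖ ≤ A := norm_average_sub_le hYc hL hYt
  have h4 : ‖Y t‖ ≤ ‖X t‖ + ‖X t - Y t‖ := by
    rw [norm_sub_rev]; simpa [add_comm] using norm_add_le (Y t - X t) (X t)
  have h5 : ‖X t‖ ≤ 2 * (m + 2) * A + ((m - 1) / 2) ^ (-(1 / (m - 1))) * A := by
    refine h1.trans (max_le ?_ ?_)
    · have : 0 ≤ ((m - 1) / 2) ^ (-(1 / (m - 1))) * A :=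
        mul_nonneg (Real.rpow_nonneg (by linarith) _) hApos.le
      linarith
    · have : 0 ≤ 2 * (m + 2) * A := mul_nonneg (by linarith) hApos.le
      linarith
  linarith

theorem ofReal_norm_sub_le_eHolder {E : Type*} [NormedAddCommGroup E] {α L a u v : ℝ}
    (hα : 0 < α) {W : ℝ → E} (hu : u ∈ Set.Icc (a - L) a)
    (hv : v ∈ Set.Icc (a - L) a) :
    ENNReal.ofReal ‖W u - W v‖ ≤ ENNReal.ofReal (L ^ α) * eHolder α (Set.Icc (a - L) a) W := by
  wlog huv : v ≤ u generalizing u v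
  · rw [norm_sub_rev]
    exact this hv hu (le_of_not_ge huv)
  rcases huv.eq_or_lt with rfl | huv
  · simp
  have hpos : 0 < u - v := sub_pos.2 huv
  have hL : u - v ≤ L := by linarith [hu.2, hv.1]
  have h1 : ENNReal.ofReal (‖W u - W v‖ / (u - v) ^ α) ≤ eHolder α (Set.Icc (a - L) a) W :=
    le_iSup₂_of_le v hv (le_iSup₂_of_le u hu (le_iSup_of_le huv le_rfl))
  calc ENNReal.ofReal ‖W u - W v‖
      = ENNReal.ofReal ((u - v) ^ α) * ENNReal.ofReal (‖W u - W v‖ / (u - v) ^ α) := by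
        rw [← ENNReal.ofReal_mul (by positivity), mul_div_cancel₀]
        exact (Real.rpow_pos_of_pos hpos α).ne'
    _ ≤ _ := by gcongr

/-- **Lemma 1.7** ([MW, Lemma 2.1]). If `Y(t) = Y(0) − ∫₀ᵗ |Y|^{m−1}Y ds + Z(t)` on `[0,1]`
with `Z(0)=0`, then for every `α ∈ (0,1)`, `t ∈ (0,1]` and `L ∈ (0,t)`,
`|Y(t)| ≤ C(m) max{ (t−L)^{−1/(m−1)}, (sup_{s∈[L,t]}[Z]_{α,[s−L,s]} L^{α−1})^{1/m},
(L^α ‖Y‖_{[0,t]}^{m−1} sup_{s∈[L,t]}[Y]_{α,[s−L,s]})^{1/m}, L^α [Y]_{α,[t−L,t]} }`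
(stated in `ℝ≥0∞` so that possibly infinite Hölder seminorms are handled faithfully). -/
theorem nonlinear_damping_bound (m : ℝ) (hm : 1 < m) :
    ∃ C : ℝ≥0∞, 0 < C ∧ C ≠ ⊤ ∧
      ∀ d : ℕ, ∀ Y Z : ℝ → EuclideanSpace ℝ (Fin d),
        ContinuousOn Y (Set.Icc 0 1) → ContinuousOn Z (Set.Icc 0 1) → Z 0 = 0 →
        (∀ t ∈ Set.Icc (0:ℝ) 1,
          Y t = Y 0 - (∫ s in (0:ℝ)..t, (‖Y s‖ ^ (m - 1)) • Y s) + Z t) →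
        ∀ α ∈ Set.Ioo (0:ℝ) 1, ∀ t ∈ Set.Ioc (0:ℝ) 1, ∀ L ∈ Set.Ioo (0:ℝ) t,
        (‖Y t‖₊ : ℝ≥0∞) ≤ C *
          (ENNReal.ofReal ((t - L) ^ (-(1 / (m - 1)))) ⊔
           ((⨆ s ∈ Set.Icc L t, eHolder α (Set.Icc (s - L) s) Z) *
              ENNReal.ofReal (L ^ (α - 1))) ^ (1 / m) ⊔
           (ENNReal.ofReal (L ^ α) * eSupNorm (Set.Icc 0 t) Y ^ (m - 1) *
              ⨆ s ∈ Set.Icc L t, eHolder α (Set.Icc (s - L) s) Y) ^ (1 / m) ⊔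
           ENNReal.ofReal (L ^ α) * eHolder α (Set.Icc (t - L) t) Y) := by
  have hC0 : 0 < 1 + 2 * (m + 2) + ((m - 1) / 2) ^ (-(1 / (m - 1))) := by
    have := Real.rpow_nonneg (show 0 ≤ (m - 1) / 2 by linarith) (-(1 / (m - 1)))
    linarith
  refine ⟨ENNReal.ofReal (1 + 2 * (m + 2) + ((m - 1) / 2) ^ (-(1 / (m - 1)))),
    ENNReal.ofReal_pos.2 hC0, ENNReal.ofReal_ne_top, ?_⟩
  intro d Y Z hY _ _ hYZ α hα t ht L hL
  have hm0 : 0 < m := by linarith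
  generalize hR : (ENNReal.ofReal ((t - L) ^ (-(1 / (m - 1)))) ⊔
           ((⨆ s ∈ Set.Icc L t, eHolder α (Set.Icc (s - L) s) Z) *
              ENNReal.ofReal (L ^ (α - 1))) ^ (1 / m) ⊔
           (ENNReal.ofReal (L ^ α) * eSupNorm (Set.Icc 0 t) Y ^ (m - 1) *
              ⨆ s ∈ Set.Icc L t, eHolder α (Set.Icc (s - L) s) Y) ^ (1 / m) ⊔
           ENNReal.ofReal (L ^ α) * eHolder α (Set.Icc (t - L) t) Y) = R
  rcases eq_or_ne R ⊤ with rfl | hRtop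
  · rw [ENNReal.mul_top (ENNReal.ofReal_pos.2 hC0).ne']
    exact le_top
  obtain ⟨A, hA0, rfl⟩ : ∃ A : ℝ, 0 ≤ A ∧ R = ENNReal.ofReal A :=
    ⟨R.toReal, ENNReal.toReal_nonneg, (ENNReal.ofReal_toReal hRtop).symm⟩
  have hR' := hR.le
  simp only [sup_le_iff] at hR'
  obtain ⟨⟨⟨h1, h2⟩, h3⟩, h4⟩ := hR'
  have hApow : ENNReal.ofReal A ^ m = ENNReal.ofReal (A ^ m) :=
    ENNReal.ofReal_rpow_of_nonneg hA0 hm0.le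
  rw [one_div, ENNReal.rpow_inv_le_iff hm0, hApow] at h2 h3
  have hmem : ∀ s ∈ Set.Icc L t, ∀ u ∈ Set.Icc (s - L) s, u ∈ Set.Icc (0 : ℝ) 1 :=
    fun s hs u hu => ⟨by linarith [hu.1, hs.1], by linarith [hu.2, hs.2, ht.2]⟩
  have htL : t ∈ Set.Icc L t := ⟨hL.2.le, le_rfl⟩
  have hLp : 0 < L := hL.1
  obtain ⟨s₀, hs₀, hmax⟩ := isCompact_Icc.exists_isMaxOn (Set.nonempty_Icc.2 ht.1.le)
    (hY.mono (Set.Icc_subset_Icc_right ht.2)).norm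
  have hsup : ENNReal.ofReal (‖Y s₀‖ ^ (m - 1)) ≤ eSupNorm (Set.Icc 0 t) Y ^ (m - 1) := by
    rw [← ENNReal.ofReal_rpow_of_nonneg (norm_nonneg _) (by linarith)]
    refine ENNReal.rpow_le_rpow ?_ (by linarith)
    rw [ofReal_norm]
    exact le_iSup₂_of_le s₀ hs₀ le_rfl
  set Y' : ℝ → EuclideanSpace ℝ (Fin d) := fun u => Y (Set.projIcc 0 1 zero_le_one u) with hY'def
  have hY'c : Continuous Y' := hY.comp_continuous
    (continuous_subtype_val.comp continuous_projIcc) fun u => (Set.projIcc 0 1 zero_le_one u).2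
  have hY' : ∀ u ∈ Set.Icc (0 : ℝ) 1, Y' u = Y u := fun u hu => by
    rw [hY'def]; simp only [Set.projIcc_of_mem zero_le_one hu]
  have hYZ' : ∀ u ∈ Set.Icc (0 : ℝ) 1,
      Y' u = Y 0 - (∫ s in (0 : ℝ)..u, ‖Y' s‖ ^ (m - 1) • Y' s) + Z u := by
    intro u hu
    rw [hY' u hu, hYZ u hu]
    congr 2
    refine intervalIntegral.integral_congr fun s hs => ?_
    rw [Set.uIcc_of_le hu.1] at hs
    simp only [hY' s ⟨hs.1, hs.2.trans hu.2⟩]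
  have hfc : Continuous fun u => ‖Y' u‖ ^ (m - 1) • Y' u :=
    (hY'c.norm.rpow_const fun _ => Or.inr (by linarith)).smul hY'c
  have key : ‖Y' t‖ ≤ (1 + 2 * (m + 2) + ((m - 1) / 2) ^ (-(1 / (m - 1)))) * A := by
    refine norm_le_of_damped_increments (M := ‖Y s₀‖) hm hLp hL.2 hY'c
      ((ENNReal.ofReal_le_ofReal_iff hA0).1 h1) ?_ ?_ ?_ ?_
    · intro s hs
      rw [hY' s ⟨hs.1, hs.2.trans ht.2⟩]
      exact hmax hs
    · intro s hs
      have hsI := hmem s hs s ⟨by linarith, le_rfl⟩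
      have hsI' := hmem s hs (s - L) ⟨le_rfl, by linarith⟩
      have heq : Y' s - Y' (s - L) + ∫ u in (s - L)..s, ‖Y' u‖ ^ (m - 1) • Y' u =
          Z s - Z (s - L) := by
        rw [hYZ' s hsI, hYZ' (s - L) hsI', ← intervalIntegral.integral_interval_sub_left
          (hfc.intervalIntegrable 0 s) (hfc.intervalIntegrable 0 (s - L))]
        abel
      rw [heq, ← ENNReal.ofReal_le_ofReal_iff (by positivity)]
      calc ENNReal.ofReal ‖Z s - Z (s - L)‖
          ≤ ENNReal.ofReal (L ^ α) * eHolder α (Set.Icc (s - L) s) Z :=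
            ofReal_norm_sub_le_eHolder hα.1 ⟨by linarith, le_rfl⟩ ⟨le_rfl, by linarith⟩
        _ ≤ ENNReal.ofReal (L ^ α) * ⨆ s ∈ Set.Icc L t, eHolder α (Set.Icc (s - L) s) Z := by
            gcongr
            exact le_iSup₂_of_le s hs le_rfl
        _ = (⨆ s ∈ Set.Icc L t, eHolder α (Set.Icc (s - L) s) Z) *
              ENNReal.ofReal (L ^ (α - 1)) * ENNReal.ofReal L := by
            rw [mul_assoc, ← ENNReal.ofReal_mul (by positivity), ← Real.rpow_add_one hLp.ne',
              sub_add_cancel, mul_comm]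
        _ ≤ ENNReal.ofReal (A ^ m) * ENNReal.ofReal L := by gcongr
        _ = ENNReal.ofReal (A ^ m * L) := (ENNReal.ofReal_mul (by positivity)).symm
    · intro s hs u hu v hv
      rw [hY' u (hmem s hs u hu), hY' v (hmem s hs v hv),
        ← ENNReal.ofReal_le_ofReal_iff (by positivity), ENNReal.ofReal_mul (by positivity)]
      calc ENNReal.ofReal (‖Y s₀‖ ^ (m - 1)) * ENNReal.ofReal ‖Y u - Y v‖
          ≤ eSupNorm (Set.Icc 0 t) Y ^ (m - 1) *
              (ENNReal.ofReal (L ^ α) * ⨆ s ∈ Set.Icc L t, eHolder α (Set.Icc (s - L) s) Y) := by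
            gcongr
            refine (ofReal_norm_sub_le_eHolder hα.1 hu hv).trans ?_
            gcongr
            exact le_iSup₂_of_le s hs le_rfl
        _ = ENNReal.ofReal (L ^ α) * eSupNorm (Set.Icc 0 t) Y ^ (m - 1) *
              ⨆ s ∈ Set.Icc L t, eHolder α (Set.Icc (s - L) s) Y := by ring
        _ ≤ _ := h3
    · intro u hu
      have htm : t ∈ Set.Icc (t - L) t := ⟨by linarith, le_rfl⟩
      rw [hY' u (hmem t htL u hu), hY' t (hmem t htL t htm), ← ENNReal.ofReal_le_ofReal_iff hA0]
      exact (ofReal_norm_sub_le_eHolder hα.1 hu htm).trans h4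
  rw [hY' t ⟨ht.1.le, ht.2⟩] at key
  rw [← ENNReal.ofReal_mul hC0.le, ← enorm_eq_nnnorm, ← ofReal_norm]
  exact ENNReal.ofReal_le_ofReal key

end
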